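/- Gärtner (microscopic Hopf–Cole) transform identity for the solid-on-solid growth model: Let p, q > 0 with p + q = 1, and let h : ℤ → ℤ satisfy |h(x+1) − h(x)| = 1 for all x ∈ ℤ. Define G(x) := (p/q)^{h(x)/2} (real power). Then for every x ∈ ℤ: p·𝟙[h(x−1) = h(x+1) = h(x) − 1]·((p/q)^{(h(x)−2)/2} − G(x)) + q·𝟙[h(x−1) = h(x+1) = h(x) + 1]·((p/q)^{(h(x)+2)/2} − G(x)) = √(pq)·(G(x+1) + G(x−1) − 2G(x)) − (1 − 2√(pq))·G(x). In words, the instantaneous drift of the exponentiated height under corner flips (a local maximum flips down by 2 at rate p, a local minimum flips up by 2 at rate q) equals exactly √(pq) times the discrete Laplacian of G minus the linear renormalization term (1 − 2√(pq))G. -/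

import Mathlib

theorem sqrt_mul_mul_rpow_add_one_div_two {p q : ℝ} (hp : 0 < p) (hq : 0 < q) (a : ℝ) :
    Real.sqrt (p * q) * (p / q) ^ ((a + 1) / 2) = p * (p / q) ^ (a / 2) := by
  have hsqrt : Real.sqrt (p * q) * Real.sqrt (p / q) = p := by
    rw [← Real.sqrt_mul (by positivity), show p * q * (p / q) = p ^ 2 by field_simp,
      Real.sqrt_sq hp.le]
  rw [add_div, Real.rpow_add (div_pos hp hq), ← Real.sqrt_eq_rpow]
  linear_combination (p / q) ^ (a / 2) * hsqrt

theorem sqrt_mul_mul_rpow_sub_one_div_two {p q : ℝ} (hp : 0 < p) (hq : 0 < q) (a : ℝ) :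
    Real.sqrt (p * q) * (p / q) ^ ((a - 1) / 2) = q * (p / q) ^ (a / 2) := by
  have hsqrt : Real.sqrt (p * q) = q * Real.sqrt (p / q) := by
    rw [show p * q = q ^ 2 * (p / q) by field_simp, Real.sqrt_mul (by positivity),
      Real.sqrt_sq hq.le]
  have hsplit : (p / q) ^ (a / 2) = (p / q) ^ ((a - 1) / 2) * Real.sqrt (p / q) := by
    rw [Real.sqrt_eq_rpow, ← Real.rpow_add (div_pos hp hq)]
    ring_nf
  rw [hsqrt, hsplit]
  ring

theorem mul_rpow_add_two_div_two {p q : ℝ} (hp : 0 < p) (hq : 0 < q) (a : ℝ) :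
    q * (p / q) ^ ((a + 2) / 2) = p * (p / q) ^ (a / 2) := by
  rw [show (a + 2) / 2 = a / 2 + 1 by ring, Real.rpow_add_one (div_pos hp hq).ne']
  field_simp

theorem mul_rpow_sub_two_div_two {p q : ℝ} (hp : 0 < p) (hq : 0 < q) (a : ℝ) :
    p * (p / q) ^ ((a - 2) / 2) = q * (p / q) ^ (a / 2) := by
  simpa using (mul_rpow_add_two_div_two hp hq (a - 2)).symm

/-- Gärtner (microscopic Hopf–Cole) transform identity for the solid-on-solid model:
for p + q = 1 and a height function with |h(x+1) − h(x)| = 1, the instantaneous drift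
of G(x) = (p/q)^(h(x)/2) under corner flips equals √(pq) times the discrete Laplacian
of G minus the renormalization term (1 − 2√(pq))·G. -/
theorem gartner_transform_identity
    (p q : ℝ) (hp : 0 < p) (hq : 0 < q) (hpq : p + q = 1)
    (h : ℤ → ℤ) (hgrad : ∀ x : ℤ, |h (x + 1) - h x| = 1) :
    ∀ x : ℤ,
      p * (if h (x - 1) = h x - 1 ∧ h (x + 1) = h x - 1 then (1 : ℝ) else 0)
          * ((p / q) ^ (((h x : ℝ) - 2) / 2) - (p / q) ^ ((h x : ℝ) / 2))
        + q * (if h (x - 1) = h x + 1 ∧ h (x + 1) = h x + 1 then (1 : ℝ) else 0)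
          * ((p / q) ^ (((h x : ℝ) + 2) / 2) - (p / q) ^ ((h x : ℝ) / 2))
        = Real.sqrt (p * q)
            * ((p / q) ^ ((h (x + 1) : ℝ) / 2) + (p / q) ^ ((h (x - 1) : ℝ) / 2)
              - 2 * (p / q) ^ ((h x : ℝ) / 2))
          - (1 - 2 * Real.sqrt (p * q)) * (p / q) ^ ((h x : ℝ) / 2) := by
  intro x
  have hup := sqrt_mul_mul_rpow_add_one_div_two hp hq (h x)
  have hdown := sqrt_mul_mul_rpow_sub_one_div_two hp hq (h x)
  have hup2 := mul_rpow_add_two_div_two hp hq (h x)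
  have hdown2 := mul_rpow_sub_two_div_two hp hq (h x)
  have hright : h (x + 1) = h x + 1 ∨ h (x + 1) = h x - 1 := by
    have := hgrad x
    grind
  have hleft : h (x - 1) = h x + 1 ∨ h (x - 1) = h x - 1 := by
    have := hgrad (x - 1)
    rw [sub_add_cancel] at this
    grind
  have hne : h x + 1 ≠ h x - 1 := by omega
  set G := (p / q) ^ ((h x : ℝ) / 2)
  rcases hright with hr | hr <;> rcases hleft with hl | hl <;>
    simp only [hr, hl, hne, hne.symm, and_self, and_true, and_false, if_true, if_false] <;>
    push_cast
  · linear_combination hup2 - 2 * hup - G * hpq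
  · linear_combination -hup - hdown - G * hpq
  · linear_combination -hup - hdown - G * hpq
  · linear_combination hdown2 - 2 * hdown - G * hpq
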